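/- Every zero-dimensional quasi weakly Radon–Nikodým compact Hausdorff space is weakly Radon–Nikodým. -/

import Mathlib

open Set Function

/-- A sequence of pairs of subsets `(A n, B n)` of a set `S` is *independent* if for every
`n` and every choice function `ε`, the intersection over `k < n` of `A k` (if `ε k = 0/false`)
or `B k` (if `ε k = 1/true`) is nonempty. -/
def IsIndependentSeq {S : Type*} (A B : ℕ → Set S) : Prop :=
  ∀ (n : ℕ) (ε : Fin n → Bool),
    (⋂ k : Fin n, if ε k = true then B (k : ℕ) else A (k : ℕ)).Nonempty

/-- A real Banach space `X` *contains an isomorphic copy of `ℓ¹`* if there is a bounded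
linear map from `ℓ¹` into `X` which is an isomorphism onto its image, i.e. bounded below. -/
def ContainsL1 (X : Type*) [NormedAddCommGroup X] [NormedSpace ℝ X] : Prop :=
  ∃ T : lp (fun _ : ℕ => ℝ) 1 →L[ℝ] X, ∃ c : ℝ, 0 < c ∧ ∀ v, c * ‖v‖ ≤ ‖T v‖

/-- A compact (Hausdorff) space is *weakly Radon–Nikodým* if it is homeomorphic to a
weak*-compact subset of the dual of a real Banach space not containing a copy of `ℓ¹`. -/
def IsWRN (K : Type*) [TopologicalSpace K] : Prop :=
  ∃ (X : Type) (_ : NormedAddCommGroup X) (_ : NormedSpace ℝ X) (_ : CompleteSpace X)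
    (S : Set (WeakDual ℝ X)), ¬ ContainsL1 X ∧ IsCompact S ∧ Nonempty (K ≃ₜ S)

/-- A compact space `K` is *quasi weakly Radon–Nikodým* (QWRN) if there is a homeomorphic
embedding `i` of `K` into `[0,1]^Γ` for some set `Γ` such that for every `ε > 0` there is a
countable decomposition `Γ = ⋃ n, Γs n` such that for every `n` and all reals `p < q` with
`q - p > ε`, the family of pairs `({x | (i x α : ℝ) < p}, {x | (i x α : ℝ) > q})`, `α ∈ Γs n`,
contains no independent sequence. -/
def IsQWRN (K : Type*) [TopologicalSpace K] : Prop :=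
  ∃ (Γ : Type) (i : K → Γ → unitInterval), Topology.IsEmbedding i ∧
    ∀ ε : ℝ, ε > 0 → ∃ Γs : ℕ → Set Γ, (⋃ n, Γs n) = Set.univ ∧
      ∀ n : ℕ, ∀ p q : ℝ, q - p > ε →
        ¬ ∃ φ : ℕ → Γ, (∀ m, φ m ∈ Γs n) ∧
          IsIndependentSeq (fun m => {x : K | (i x (φ m) : ℝ) < p})
                           (fun m => {x : K | (i x (φ m) : ℝ) > q})

open MeasureTheory Filter Topology
open scoped ENNReal

/-- A class of sets closed under countable unions has a member which, up to null sets, contains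
every measurable member of the class. -/
theorem exists_ae_largest_of_iUnion_closed {Ω : Type*} [MeasurableSpace Ω] (ν : Measure Ω)
    [IsFiniteMeasure ν] (P : Set Ω → Prop) (h0 : P ∅)
    (hP : ∀ E : ℕ → Set Ω, (∀ n, MeasurableSet (E n) ∧ P (E n)) → P (⋃ n, E n)) :
    ∃ M, MeasurableSet M ∧ P M ∧ ∀ E, MeasurableSet E → P E → ν (E \ M) = 0 := by
  have hne : (ν '' {E | MeasurableSet E ∧ P E}).Nonempty := ⟨_, ∅, ⟨MeasurableSet.empty, h0⟩, rfl⟩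
  obtain ⟨u, -, hu, hmem⟩ := exists_seq_tendsto_sSup hne (OrderTop.bddAbove _)
  choose E hE hEu using hmem
  have hM : MeasurableSet (⋃ n, E n) := MeasurableSet.iUnion fun n => (hE n).1
  refine ⟨⋃ n, E n, hM, hP E hE, fun F hF hPF => ?_⟩
  have hle : sSup (ν '' {E | MeasurableSet E ∧ P E}) ≤ ν (⋃ n, E n) :=
    le_of_tendsto' hu fun n => by
      rw [← hEu n]
      exact measure_mono (subset_iUnion E n)
  have hun : P ((⋃ n, E n) ∪ F) := by
    have : (⋃ n, E n) ∪ F = ⋃ n : ℕ, (E n ∪ F) := by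
      rw [iUnion_union]
    rw [this]
    refine hP _ fun n => ⟨(hE n).1.union hF, ?_⟩
    have : E n ∪ F = ⋃ k : ℕ, (if k = 0 then E n else F) := by
      ext x
      simp only [mem_union, mem_iUnion]
      constructor
      · rintro (h | h)
        · exact ⟨0, by simpa using h⟩
        · exact ⟨1, by simpa using h⟩
      · rintro ⟨k, hk⟩
        split_ifs at hk
        · exact Or.inl hk
        · exact Or.inr hk
    rw [this]
    refine hP _ fun k => ?_
    split_ifs
    · exact hE n
    · exact ⟨hF, hPF⟩
  have hmem : (⋃ n, E n) ∪ F ∈ {E | MeasurableSet E ∧ P E} := ⟨hM.union hF, hun⟩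
  have hle' : ν ((⋃ n, E n) ∪ F) ≤ ν (⋃ n, E n) :=
    (le_sSup (mem_image_of_mem ν hmem)).trans hle
  rw [← union_sdiff_self, measure_union disjoint_sdiff_self_right (hF.diff hM)] at hle'
  have hfin : ν (⋃ n, E n) ≠ ∞ := measure_ne_top _ _
  by_contra hne0
  exact absurd hle' (not_le.2 (ENNReal.lt_add_right hfin hne0))

/-- The sets on which a family of sets becomes negligible along a filter are closed under countable
unions. -/
theorem tendsto_measure_iUnion_inter {Ω Γ : Type*} [MeasurableSpace Ω] (ν : Measure Ω)
    [IsFiniteMeasure ν] (l : Filter Γ) (A : Γ → Set Ω) (E : ℕ → Set Ω)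
    (hE : ∀ n, MeasurableSet (E n))
    (h : ∀ n, Tendsto (fun a => ν (E n ∩ A a)) l (𝓝 0)) :
    Tendsto (fun a => ν ((⋃ n, E n) ∩ A a)) l (𝓝 0) := by
  rw [ENNReal.tendsto_nhds_zero]
  intro η hη
  have hacc : ∀ n, MeasurableSet (accumulate E n) := fun n =>
    MeasurableSet.biUnion (to_countable _) fun i _ => hE i
  have hanti : Antitone fun n => (⋃ n, E n) \ accumulate E n := fun m n hmn =>
    sdiff_subset_sdiff_right (monotone_accumulate hmn)
  have hlim : Tendsto (fun n => ν ((⋃ n, E n) \ accumulate E n)) atTop (𝓝 0) := by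
    have := tendsto_measure_iInter_atTop (μ := ν)
      (fun n => ((MeasurableSet.iUnion hE).diff (hacc n)).nullMeasurableSet) hanti
      ⟨0, measure_ne_top _ _⟩
    rwa [← sdiff_iUnion, iUnion_accumulate, sdiff_self, measure_empty] at this
  have hη2 : 0 < η / 2 := ENNReal.half_pos hη.ne'
  obtain ⟨N, hN⟩ := (ENNReal.tendsto_nhds_zero.1 hlim _ hη2).exists
  have hsum : Tendsto (fun a => ∑ n ∈ Finset.range (N + 1), ν (E n ∩ A a)) l (𝓝 0) := by
    simpa using tendsto_finsetSum (Finset.range (N + 1)) fun n _ => h n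
  filter_upwards [ENNReal.tendsto_nhds_zero.1 hsum _ hη2] with a ha
  calc ν ((⋃ n, E n) ∩ A a)
      ≤ ν (((⋃ n, E n) \ accumulate E N) ∪ ⋃ n ∈ Finset.range (N + 1), (E n ∩ A a)) := by
        refine measure_mono fun x hx => ?_
        by_cases hxN : x ∈ accumulate E N
        · right
          obtain ⟨k, hk, hxk⟩ := mem_accumulate.1 hxN
          simp only [mem_iUnion]
          exact ⟨k, Finset.mem_range.2 (by omega), hxk, hx.2⟩
        · exact Or.inl ⟨hx.1, hxN⟩
    _ ≤ η / 2 + η / 2 := (measure_union_le _ _).trans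
        (add_le_add hN ((measure_biUnion_finset_le _ _).trans ha))
    _ = η := ENNReal.add_halves η

open Classical in
/-- If, on every non-null part of a non-null set, both members of the pairs are eventually
non-null, then an independent sequence of pairs exists. -/
theorem exists_isIndependentSeq_of_eventually_pos {Ω Γ : Type*} [MeasurableSpace Ω]
    (ν : Measure Ω) (l : Filter Γ) [l.NeBot] (A B : Γ → Set Ω)
    (hA : ∀ a, MeasurableSet (A a)) (hB : ∀ a, MeasurableSet (B a)) {G : Set Γ} (hG : G ∈ l)
    {E₀ : Set Ω} (hE₀ : MeasurableSet E₀) (hpos : ν E₀ ≠ 0)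
    (h : ∀ E ⊆ E₀, MeasurableSet E → ν E ≠ 0 →
      ∀ᶠ a in l, ν (E ∩ A a) ≠ 0 ∧ ν (E ∩ B a) ≠ 0) :
    ∃ φ : ℕ → Γ, (∀ m, φ m ∈ G) ∧
      IsIndependentSeq (fun m => A (φ m)) (fun m => B (φ m)) := by
  let good : Finset (Set Ω) → Prop := fun C => ∀ E ∈ C, E ⊆ E₀ ∧ MeasurableSet E ∧ ν E ≠ 0
  have step : ∀ C : {C // good C}, ∃ a ∈ G, ∀ E ∈ C.1, ν (E ∩ A a) ≠ 0 ∧ ν (E ∩ B a) ≠ 0 := by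
    intro C
    have h1 : ∀ᶠ a in l, ∀ E ∈ C.1, ν (E ∩ A a) ≠ 0 ∧ ν (E ∩ B a) ≠ 0 :=
      (Filter.eventually_all_finset C.1).2 fun E hE =>
        h E (C.2 E hE).1 (C.2 E hE).2.1 (C.2 E hE).2.2
    obtain ⟨a, ha, haG⟩ := (h1.and hG).exists
    exact ⟨a, haG, ha⟩
  choose g hgG hg using step
  let next : {C // good C} → {C // good C} := fun C =>
    ⟨C.1.image (· ∩ A (g C)) ∪ C.1.image (· ∩ B (g C)), by
      intro F hF
      rcases Finset.mem_union.1 hF with hF | hF <;>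
      · obtain ⟨E, hE, rfl⟩ := Finset.mem_image.1 hF
        refine ⟨inter_subset_left.trans (C.2 E hE).1, (C.2 E hE).2.1.inter (by simp [hA, hB]), ?_⟩
        first | exact (hg C E hE).1 | exact (hg C E hE).2⟩
  let S : ℕ → {C // good C} := fun n => Nat.rec
    ⟨{E₀}, by simpa [good] using ⟨hE₀, hpos⟩⟩ (fun _ C => next C) n
  refine ⟨fun n => g (S n), fun m => hgG _, fun n ε => ?_⟩
  have key : ∀ (ε : ℕ → Bool) (n : ℕ), ∃ E ∈ (S n).1,
      ∀ k < n, E ⊆ if ε k = true then B (g (S k)) else A (g (S k)) := by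
    intro ε n
    induction n with
    | zero => exact ⟨E₀, by simp [S], by simp⟩
    | succ n ih =>
      obtain ⟨E, hE, hEs⟩ := ih
      refine ⟨E ∩ (if ε n = true then B (g (S n)) else A (g (S n))), ?_, fun k hk => ?_⟩
      · change _ ∈ (next (S n)).1
        refine Finset.mem_union.2 ?_
        split_ifs
        · exact Or.inr (Finset.mem_image_of_mem _ hE)
        · exact Or.inl (Finset.mem_image_of_mem _ hE)
      · rcases Nat.lt_succ_iff_lt_or_eq.1 hk with hk | rfl
        · exact inter_subset_left.trans (hEs k hk)
        · exact inter_subset_right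
  obtain ⟨E, hE, hEs⟩ := key (fun k => if hk : k < n then ε ⟨k, hk⟩ else false) n
  obtain ⟨x, hx⟩ := nonempty_of_measure_ne_zero ((S n).2 E hE).2.2
  refine ⟨x, mem_iInter.2 fun k => ?_⟩
  simpa using hEs k k.2 hx

/-- Without independent sequences, the sets `A a ∩ B b` become negligible along an ultrafilter. -/
theorem tendsto_measure_inter_of_not_isIndependentSeq {Ω Γ : Type*} [MeasurableSpace Ω]
    (ν : Measure Ω) [IsFiniteMeasure ν] (𝒰 : Ultrafilter Γ) (A B : Γ → Set Ω)
    (hA : ∀ a, MeasurableSet (A a)) (hB : ∀ a, MeasurableSet (B a)) {G : Set Γ} (hG : G ∈ 𝒰)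
    (h : ¬ ∃ φ : ℕ → Γ, (∀ m, φ m ∈ G) ∧
      IsIndependentSeq (fun m => A (φ m)) (fun m => B (φ m))) :
    Tendsto (fun z : Γ × Γ => ν (A z.1 ∩ B z.2)) ((𝒰 : Filter Γ) ×ˢ (𝒰 : Filter Γ)) (𝓝 0) := by
  have hex : ∀ D : Γ → Set Ω, ∃ M, MeasurableSet M ∧
      Tendsto (fun a => ν (M ∩ D a)) 𝒰 (𝓝 0) ∧
      ∀ E, MeasurableSet E → Tendsto (fun a => ν (E ∩ D a)) 𝒰 (𝓝 0) → ν (E \ M) = 0 := fun D =>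
    exists_ae_largest_of_iUnion_closed ν (fun E => Tendsto (fun a => ν (E ∩ D a)) 𝒰 (𝓝 0))
      (by simp) fun E hE =>
        tendsto_measure_iUnion_inter ν 𝒰 D E (fun n => (hE n).1) fun n => (hE n).2
  have hev : ∀ (D : Γ → Set Ω) (E : Set Ω), ¬ Tendsto (fun a => ν (E ∩ D a)) 𝒰 (𝓝 0) →
      ∀ᶠ a in (𝒰 : Filter Γ), ν (E ∩ D a) ≠ 0 := by
    intro D E hE
    by_contra hcon
    refine hE (Tendsto.congr' ?_ tendsto_const_nhds)
    have := Ultrafilter.eventually_not.2 hcon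
    filter_upwards [this] with a ha
    simpa using (not_not.1 ha).symm
  obtain ⟨M, hM, hMA, hMmax⟩ := hex A
  obtain ⟨N, hN, hNB, hNmax⟩ := hex B
  have hnull : ν (M ∪ N)ᶜ = 0 := by
    by_contra hne
    refine h (exists_isIndependentSeq_of_eventually_pos ν 𝒰 A B hA hB hG (hM.union hN).compl hne
      fun E hE hEm hEpos => (hev A E fun hT => hEpos ?_).and (hev B E fun hT => hEpos ?_))
    · rw [← hMmax E hEm hT, Disjoint.sdiff_eq_left]
      exact disjoint_left.2 fun x hx hxM => hE hx (Or.inl hxM)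
    · rw [← hNmax E hEm hT, Disjoint.sdiff_eq_left]
      exact disjoint_left.2 fun x hx hxN => hE hx (Or.inr hxN)
  have hsum : Tendsto (fun z : Γ × Γ => ν (M ∩ A z.1) + ν (N ∩ B z.2))
      ((𝒰 : Filter Γ) ×ˢ (𝒰 : Filter Γ)) (𝓝 0) := by
    simpa using (hMA.comp tendsto_fst).add (hNB.comp tendsto_snd)
  refine tendsto_of_tendsto_of_tendsto_of_le_of_le tendsto_const_nhds hsum
    (fun _ => zero_le) fun z => ?_
  calc ν (A z.1 ∩ B z.2) ≤ ν (((M ∩ A z.1) ∪ (N ∩ B z.2)) ∪ (M ∪ N)ᶜ) := by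
        refine measure_mono fun x hx => ?_
        by_cases h1 : x ∈ M
        · exact Or.inl (Or.inl ⟨h1, hx.1⟩)
        by_cases h2 : x ∈ N
        · exact Or.inl (Or.inr ⟨h2, hx.2⟩)
        · exact Or.inr fun hx' => hx'.elim h1 h2
    _ ≤ ν (M ∩ A z.1) + ν (N ∩ B z.2) + 0 := (measure_union_le _ _).trans
        (add_le_add (measure_union_le _ _) hnull.le)
    _ = _ := add_zero _

/-- If a family of `[0,1]`-valued functions has no independent sequences at oscillation level `ε`,
then along an ultrafilter it is Cauchy in measure up to an error of size `δ ≥ 4ε`. -/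
theorem tendsto_measure_le_abs_sub {Ω Γ : Type*} [MeasurableSpace Ω]
    (ν : Measure Ω) [IsFiniteMeasure ν] (𝒰 : Ultrafilter Γ) (f : Γ → Ω → unitInterval)
    (hf : ∀ a, Measurable (f a)) {G : Set Γ} (hG : G ∈ 𝒰) {ε δ : ℝ} (hδ : 0 < δ)
    (hεδ : 4 * ε ≤ δ)
    (h : ∀ p q : ℝ, q - p > ε → ¬ ∃ φ : ℕ → Γ, (∀ m, φ m ∈ G) ∧
      IsIndependentSeq (fun m => {x | (f (φ m) x : ℝ) < p}) (fun m => {x | (f (φ m) x : ℝ) > q})) :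
    Tendsto (fun z : Γ × Γ => ν {x | δ ≤ |(f z.1 x : ℝ) - f z.2 x|})
      ((𝒰 : Filter Γ) ×ˢ (𝒰 : Filter Γ)) (𝓝 0) := by
  set s := δ / 4 with hs
  have hs0 : 0 < s := by positivity
  have hfm : ∀ a, Measurable fun x => (f a x : ℝ) := fun a => measurable_subtype_coe.comp (hf a)
  let V : ℕ → Γ × Γ → Set Ω := fun j z =>
    {x | (f z.1 x : ℝ) < (j + 1) * s} ∩ {x | (f z.2 x : ℝ) > (j + 3) * s}
  have hV : ∀ j, Tendsto (fun z => ν (V j z)) ((𝒰 : Filter Γ) ×ˢ (𝒰 : Filter Γ)) (𝓝 0) := fun j =>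
    tendsto_measure_inter_of_not_isIndependentSeq ν 𝒰
      (fun a => {x | (f a x : ℝ) < (j + 1) * s}) (fun a => {x | (f a x : ℝ) > (j + 3) * s})
      (fun a => measurableSet_lt (hfm a) measurable_const)
      (fun a => measurableSet_lt measurable_const (hfm a)) hG (h _ _ (by linarith))
  have hV' : ∀ j, Tendsto (fun z : Γ × Γ => ν (V j z.swap))
      ((𝒰 : Filter Γ) ×ˢ (𝒰 : Filter Γ)) (𝓝 0) := fun j => (hV j).comp tendsto_prod_swap
  set N := ⌊1 / s⌋₊ + 1 with hN
  have hsum : Tendsto (fun z : Γ × Γ => ∑ j ∈ Finset.range N, (ν (V j z) + ν (V j z.swap)))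
      ((𝒰 : Filter Γ) ×ˢ (𝒰 : Filter Γ)) (𝓝 0) := by
    simpa using tendsto_finsetSum (Finset.range N) fun j _ => (hV j).add (hV' j)
  refine tendsto_of_tendsto_of_tendsto_of_le_of_le tendsto_const_nhds hsum
    (fun _ => zero_le) fun z => ?_
  have hcell : ∀ u v : unitInterval, δ ≤ (v : ℝ) - u →
      ∃ j ∈ Finset.range N, (u : ℝ) < (j + 1) * s ∧ (v : ℝ) > (j + 3) * s := by
    intro u v huv
    refine ⟨⌊(u : ℝ) / s⌋₊, ?_, ?_, ?_⟩
    · rw [Finset.mem_range, hN, Nat.lt_succ_iff]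
      exact Nat.floor_mono (div_le_div_of_nonneg_right u.2.2 hs0.le)
    · exact (div_lt_iff₀ hs0).1 (Nat.lt_floor_add_one _)
    · have := (le_div_iff₀ hs0).1 (Nat.floor_le (div_nonneg u.2.1 hs0.le))
      linarith
  calc ν {x | δ ≤ |(f z.1 x : ℝ) - f z.2 x|}
      ≤ ν (⋃ j ∈ Finset.range N, (V j z ∪ V j z.swap)) := by
        refine measure_mono fun x hx => ?_
        simp only [mem_iUnion]
        rcases le_abs'.1 (show δ ≤ |(f z.1 x : ℝ) - f z.2 x| from hx) with hx | hx
        · obtain ⟨j, hj, h1, h2⟩ := hcell (f z.1 x) (f z.2 x) (by linarith)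
          exact ⟨j, hj, Or.inl ⟨h1, h2⟩⟩
        · obtain ⟨j, hj, h1, h2⟩ := hcell (f z.2 x) (f z.1 x) hx
          exact ⟨j, hj, Or.inr ⟨h1, h2⟩⟩
    _ ≤ _ := (measure_biUnion_finset_le _ _).trans
        (Finset.sum_le_sum fun j _ => measure_union_le _ _)

/-- The characteristic function of a clopen set. -/
noncomputable def clopenIndicator {K : Type*} [TopologicalSpace K]
    (C : TopologicalSpace.Clopens K) : C(K, ℝ) :=
  ⟨(C : Set K).indicator 1, C.isClopen.continuous_indicator continuous_one⟩

section CompactSpace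

variable {K : Type*} [TopologicalSpace K] [CompactSpace K] [MeasurableSpace K] [BorelSpace K]

/-- The canonical map from `C(K)` to `L¹(ν)`. -/
noncomputable abbrev toL1 (ν : Measure K) [IsFiniteMeasure ν] : C(K, ℝ) →L[ℝ] Lp ℝ 1 ν :=
  ContinuousMap.toLp 1 ν ℝ

theorem integrable_continuousMap (ν : Measure K) [IsFiniteMeasure ν] (f : C(K, ℝ)) :
    Integrable f ν :=
  memLp_one_iff_integrable.1 (f.memLp ν (p := 1) ℝ)

theorem norm_toL1 (ν : Measure K) [IsFiniteMeasure ν] (f : C(K, ℝ)) :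
    ‖toL1 ν f‖ = ∫ x, |f x| ∂ν := by
  rw [L1.norm_eq_integral_norm]
  refine integral_congr_ae ?_
  filter_upwards [ContinuousMap.coeFn_toLp (p := 1) (𝕜 := ℝ) ν f] with x hx
  rw [hx, Real.norm_eq_abs]

theorem dist_toL1 (ν : Measure K) [IsFiniteMeasure ν] (f g : C(K, ℝ)) :
    dist (toL1 ν f) (toL1 ν g) = ∫ x, |f x - g x| ∂ν := by
  rw [dist_eq_norm, ← map_sub, norm_toL1]
  rfl

theorem totallyBounded_image_of_forall_ultrafilter {α β : Type*} [PseudoMetricSpace β] (J : α → β)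
    (s : Set α) (h : ∀ 𝒰 : Ultrafilter α, s ∈ 𝒰 →
      Tendsto (fun z : α × α => dist (J z.1) (J z.2)) ((𝒰 : Filter α) ×ˢ (𝒰 : Filter α)) (𝓝 0)) :
    TotallyBounded (J '' s) := by
  refine totallyBounded_iff_ultrafilter.2 fun 𝒱 h𝒱 => ?_
  have hmem : J '' s ∈ 𝒱 := le_principal_iff.1 h𝒱
  rw [← Ultrafilter.ofComapInfPrincipal_eq_of_map hmem, Ultrafilter.coe_map, cauchy_map_iff]
  refine ⟨inferInstance, ?_⟩
  rw [Metric.uniformity_eq_comap_nhds_zero, tendsto_comap_iff]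
  exact h _ (Ultrafilter.ofComapInfPrincipal_mem hmem)

/-- Clopen sets which are uniformly approximated by one fixed function of finitely many coordinates,
all taken from families without independent sequences, form a totally bounded subset of `L¹`. -/
theorem totallyBounded_clopenIndicator (ν : Measure K) [IsFiniteMeasure ν] {Γ : Type*}
    (F : Γ → C(K, unitInterval)) {n : ℕ} (P : (Fin n → unitInterval) → ℝ) {ε δ : ℝ} (hδ : 0 < δ)
    (hεδ : 4 * ε ≤ δ) (hP : ∀ u v, dist u v < δ → |P u - P v| < 1 / 2) (G : Fin n → Set Γ)
    (hG : ∀ j, ∀ p q : ℝ, q - p > ε → ¬ ∃ φ : ℕ → Γ, (∀ m, φ m ∈ G j) ∧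
      IsIndependentSeq (fun m => {x | (F (φ m) x : ℝ) < p}) (fun m => {x | (F (φ m) x : ℝ) > q})) :
    TotallyBounded ((fun C => toL1 ν (clopenIndicator C)) '' {C | ∃ a : Fin n → Γ,
      (∀ j, a j ∈ G j) ∧ ∀ x, |P (fun j => F (a j) x) - clopenIndicator C x| ≤ 1 / 4}) := by
  refine totallyBounded_image_of_forall_ultrafilter _ _ fun 𝒰 h𝒰 => ?_
  obtain ⟨-, a₀, -⟩ := 𝒰.nonempty_of_mem h𝒰
  have : Nonempty (Fin n → Γ) := ⟨a₀⟩
  have hex : ∀ C, (∃ a : Fin n → Γ,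
      (∀ j, a j ∈ G j) ∧ ∀ x, |P (fun j => F (a j) x) - clopenIndicator C x| ≤ 1 / 4) →
      ∃ a : Fin n → Γ,
      (∀ j, a j ∈ G j) ∧ ∀ x, |P (fun j => F (a j) x) - clopenIndicator C x| ≤ 1 / 4 := fun C h => h
  choose! a ha using hex
  have hj : ∀ j, Tendsto (fun z : TopologicalSpace.Clopens K × TopologicalSpace.Clopens K =>
      ν.real {x | δ ≤ |(F (a z.1 j) x : ℝ) - F (a z.2 j) x|})
      ((𝒰 : Filter _) ×ˢ (𝒰 : Filter _)) (𝓝 0) := by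
    intro j
    have hGj : G j ∈ 𝒰.map fun C => a C j :=
      Ultrafilter.mem_map.2 (mem_of_superset h𝒰 fun C hC => (ha C hC).1 j)
    have h1 := tendsto_measure_le_abs_sub ν (𝒰.map fun C => a C j) (fun b x => F b x)
      (fun b => (F b).continuous.measurable) hGj hδ hεδ (hG j)
    rw [Ultrafilter.coe_map] at h1
    have h2 := h1.comp ((tendsto_map (f := fun C => a C j) (x := (𝒰 : Filter _))).prodMap
      (tendsto_map (f := fun C => a C j) (x := (𝒰 : Filter _))))
    exact (ENNReal.tendsto_toReal ENNReal.zero_ne_top).comp h2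
  have hsum := tendsto_finsetSum Finset.univ fun j _ => hj j
  simp only [Finset.sum_const_zero] at hsum
  refine tendsto_of_tendsto_of_tendsto_of_le_of_le' tendsto_const_nhds hsum
    (Eventually.of_forall fun _ => dist_nonneg) ?_
  filter_upwards [prod_mem_prod h𝒰 h𝒰] with z hz
  set S := ⋃ j ∈ (Finset.univ : Finset (Fin n)),
    {x | δ ≤ |(F (a z.1 j) x : ℝ) - F (a z.2 j) x|} with hS
  have hSm : MeasurableSet S := by
    refine Finset.measurableSet_biUnion _ fun j _ => (isClosed_le continuous_const ?_).measurableSet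
    fun_prop
  rw [dist_toL1]
  calc ∫ x, |clopenIndicator z.1 x - clopenIndicator z.2 x| ∂ν
      ≤ ∫ x, S.indicator 1 x ∂ν := by
        refine integral_mono
          ((integrable_continuousMap ν (clopenIndicator z.1 - clopenIndicator z.2)).abs)
          ((integrable_const (1 : ℝ)).indicator hSm) fun x => ?_
        have h1 := (ha z.1 hz.1).2 x
        have h2 := (ha z.2 hz.2).2 x
        by_cases hx : x ∈ S
        · rw [indicator_of_mem hx]
          simp only [clopenIndicator, ContinuousMap.coe_mk, indicator]
          split_ifs <;> simp
        · rw [indicator_of_notMem hx]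
          have hd : dist (fun j => F (a z.1 j) x) (fun j => F (a z.2 j) x) < δ := by
            refine (dist_pi_lt_iff hδ).2 fun j => ?_
            by_contra hcon
            refine hx (mem_iUnion₂.2 ⟨j, Finset.mem_univ j, ?_⟩)
            exact not_lt.1 hcon
          have h3 := abs_lt.1 (hP _ _ hd)
          rw [abs_le] at h1 h2
          simp only [clopenIndicator, ContinuousMap.coe_mk, indicator, Pi.one_apply] at h1 h2 ⊢
          split_ifs at h1 h2 ⊢ <;> first | (exfalso; linarith) | simp
    _ = ν.real S := integral_indicator_one hSm
    _ ≤ _ := measureReal_biUnion_finset_le _ _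

end CompactSpace

/-- Stone–Weierstrass: if the functions `F α` separate points, then every continuous function is
uniformly close to a continuous function of finitely many of them. -/
theorem exists_continuousMap_comp_near {K Γ : Type*} [TopologicalSpace K] [CompactSpace K]
    (F : Γ → C(K, unitInterval)) (hF : ∀ x y, x ≠ y → ∃ α, F α x ≠ F α y) (f : C(K, ℝ)) {η : ℝ}
    (hη : 0 < η) :
    ∃ (n : ℕ) (a : Fin n → Γ) (Q : C(Fin n → unitInterval, ℝ)),
      ∀ x, |Q (fun j => F (a j) x) - f x| < η := by
  let c : Γ → C(K, ℝ) := fun α => ⟨fun x => (F α x : ℝ), by fun_prop⟩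
  have hsep : (Algebra.adjoin ℝ (range c)).SeparatesPoints := by
    intro x y hxy
    obtain ⟨α, hα⟩ := hF x y hxy
    exact ⟨c α, ⟨c α, Algebra.subset_adjoin ⟨α, rfl⟩, rfl⟩, fun h => hα (Subtype.ext h)⟩
  obtain ⟨⟨g, hg⟩, hgf⟩ :=
    ContinuousMap.exists_mem_subalgebra_near_continuousMap_of_separatesPoints _ hsep f η hη
  rw [Algebra.adjoin_range_eq_range_aeval] at hg
  obtain ⟨p, rfl⟩ := hg
  obtain ⟨n, a, -, q, rfl⟩ := MvPolynomial.exists_fin_rename p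
  let X : Fin n → C(Fin n → unitInterval, ℝ) := fun j => ⟨fun u => (u j : ℝ), by fun_prop⟩
  let Φ : C(K, Fin n → unitInterval) := ⟨fun x j => F (a j) x, by fun_prop⟩
  refine ⟨n, a, MvPolynomial.aeval X q, fun x => ?_⟩
  have h1 : ContinuousMap.compRightAlgHom ℝ ℝ Φ (MvPolynomial.aeval X q) =
      MvPolynomial.aeval c (MvPolynomial.rename a q) := by
    rw [MvPolynomial.aeval_rename]
    exact MvPolynomial.comp_aeval_apply X (ContinuousMap.compRightAlgHom ℝ ℝ Φ) q
  change ‖MvPolynomial.aeval c (MvPolynomial.rename a q) - f‖ < η at hgf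
  refine lt_of_le_of_lt ?_ hgf
  have h2 := ContinuousMap.norm_coe_le_norm
    (MvPolynomial.aeval c (MvPolynomial.rename a q) - f) x
  rw [← h1] at h2 ⊢
  exact h2

/-- The clopen subsets of a QWRN compact space split into countably many pieces, each of which is
totally bounded in `L¹(ν)` for every finite measure `ν`. -/
theorem exists_rank_totallyBounded_clopenIndicator {K Γ : Type*} [TopologicalSpace K]
    [CompactSpace K] [MeasurableSpace K] [BorelSpace K]
    (F : Γ → C(K, unitInterval)) (hF : ∀ x y, x ≠ y → ∃ α, F α x ≠ F α y)
    (hq : ∀ ε : ℝ, ε > 0 → ∃ Γs : ℕ → Set Γ, (⋃ n, Γs n) = Set.univ ∧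
      ∀ n : ℕ, ∀ p q : ℝ, q - p > ε →
        ¬ ∃ φ : ℕ → Γ, (∀ m, φ m ∈ Γs n) ∧
          IsIndependentSeq (fun m => {x : K | (F (φ m) x : ℝ) < p})
                           (fun m => {x : K | (F (φ m) x : ℝ) > q})) :
    ∃ rank : TopologicalSpace.Clopens K → ℕ, ∀ (n : ℕ) (ν : Measure K) [IsFiniteMeasure ν],
      TotallyBounded ((fun C => toL1 ν (clopenIndicator C)) '' {C | rank C = n}) := by
  choose! Γs hΓ hind using hq
  let P : ∀ n : ℕ, ℕ → C(Fin n → unitInterval, ℝ) := fun n =>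
    TopologicalSpace.denseSeq C(Fin n → unitInterval, ℝ)
  have hδ : ∀ (n m : ℕ), ∃ δ > 0, ∀ u v, dist u v < δ → |P n m u - P n m v| < 1 / 2 := by
    intro n m
    have h := Metric.uniformContinuous_iff.1
      (CompactSpace.uniformContinuous_of_continuous (P n m).continuous) (1 / 2) (by norm_num)
    obtain ⟨δ, h0, h⟩ := h
    exact ⟨δ, h0, fun u v huv => h huv⟩
  choose δ hδ0 hδ using hδ
  have key : ∀ C : TopologicalSpace.Clopens K, ∃ t : Σ n : ℕ, ℕ × (Fin n → ℕ),
      ∃ a : Fin t.1 → Γ, (∀ j, a j ∈ Γs (δ t.1 t.2.1 / 4) (t.2.2 j)) ∧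
        ∀ x, |P t.1 t.2.1 (fun j => F (a j) x) - clopenIndicator C x| ≤ 1 / 4 := by
    intro C
    obtain ⟨n, a, Q, hQ⟩ := exists_continuousMap_comp_near F hF (clopenIndicator C)
      (η := 1 / 8) (by norm_num)
    obtain ⟨m, hm⟩ := (TopologicalSpace.denseRange_denseSeq C(Fin n → unitInterval, ℝ)).exists_dist_lt
      Q (ε := 1 / 8) (by norm_num)
    have hκ : ∀ j, ∃ k, a j ∈ Γs (δ n m / 4) k := fun j => by
      have : a j ∈ ⋃ k, Γs (δ n m / 4) k := by
        rw [hΓ _ (by have := hδ0 n m; positivity)]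
        trivial
      exact mem_iUnion.1 this
    choose κ hκ using hκ
    refine ⟨⟨n, m, κ⟩, a, hκ, fun x => ?_⟩
    have h1 := (ContinuousMap.dist_apply_le_dist (fun j => F (a j) x)).trans hm.le
    rw [Real.dist_eq, abs_sub_comm] at h1
    have h2 := (abs_sub_le (P n m fun j => F (a j) x) (Q fun j => F (a j) x)
      (clopenIndicator C x)).trans (add_le_add h1 (hQ x).le)
    exact h2.trans (by norm_num)
  choose t a ha hta using key
  refine ⟨fun C => Encodable.encode (t C), fun n ν _ => ?_⟩
  by_cases hn : ∃ C, Encodable.encode (t C) = n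
  · obtain ⟨C₀, rfl⟩ := hn
    refine (totallyBounded_clopenIndicator ν F (P (t C₀).1 (t C₀).2.1) (hδ0 _ _) (by linarith)
      (hδ _ _) (fun j => Γs (δ (t C₀).1 (t C₀).2.1 / 4) ((t C₀).2.2 j))
      fun j => hind _ (by have := hδ0 (t C₀).1 (t C₀).2.1; positivity) _).subset (image_mono ?_)
    intro C hC
    have htC : t C = t C₀ := Encodable.encode_injective hC
    rw [mem_ofPred_eq, ← htC]
    exact ⟨a C, ha C, hta C⟩
  · convert totallyBounded_empty
    exact image_eq_empty.2 (eq_empty_of_forall_notMem fun C hC => hn ⟨C, hC⟩)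

/-- On a zero-dimensional QWRN compact space there is a point-separating bounded family of continuous
functions that is totally bounded in `L¹(ν)` for every finite measure `ν`. -/
theorem exists_separating_totallyBounded {K Γ : Type*} [TopologicalSpace K]
    [CompactSpace K] [MeasurableSpace K] [BorelSpace K]
    (hK : ∀ x y : K, x ≠ y → ∃ C : TopologicalSpace.Clopens K, x ∈ C ∧ y ∉ C)
    (F : Γ → C(K, unitInterval)) (hF : ∀ x y, x ≠ y → ∃ α, F α x ≠ F α y)
    (hq : ∀ ε : ℝ, ε > 0 → ∃ Γs : ℕ → Set Γ, (⋃ n, Γs n) = Set.univ ∧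
      ∀ n : ℕ, ∀ p q : ℝ, q - p > ε →
        ¬ ∃ φ : ℕ → Γ, (∀ m, φ m ∈ Γs n) ∧
          IsIndependentSeq (fun m => {x : K | (F (φ m) x : ℝ) < p})
                           (fun m => {x : K | (F (φ m) x : ℝ) > q})) :
    ∃ w : TopologicalSpace.Clopens K → C(K, ℝ), (∀ C, ‖w C‖ ≤ 1) ∧
      (∀ x y, x ≠ y → ∃ C, w C x ≠ w C y) ∧
      ∀ (ν : Measure K) [IsFiniteMeasure ν], TotallyBounded (range fun C => toL1 ν (w C)) := by
  obtain ⟨rank, hrank⟩ := exists_rank_totallyBounded_clopenIndicator F hF hq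
  have hnorm : ∀ C : TopologicalSpace.Clopens K, ‖clopenIndicator C‖ ≤ 1 := fun C => by
    refine (ContinuousMap.norm_le _ zero_le_one).2 fun x => ?_
    simp only [clopenIndicator, ContinuousMap.coe_mk, indicator, Pi.one_apply]
    split_ifs <;> simp
  have hpos : ∀ n : ℕ, (0 : ℝ) < ((n : ℝ) + 1)⁻¹ := fun n => by positivity
  refine ⟨fun C => ((rank C : ℝ) + 1)⁻¹ • clopenIndicator C, fun C => ?_, fun x y hxy => ?_,
    fun ν _ => ?_⟩
  · rw [norm_smul, Real.norm_of_nonneg (hpos _).le]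
    have : ((rank C : ℝ) + 1)⁻¹ ≤ 1 := inv_le_one_of_one_le₀ (by simp)
    exact mul_le_one₀ this (norm_nonneg _) (hnorm C)
  · obtain ⟨C, hx, hy⟩ := hK x y hxy
    refine ⟨C, ?_⟩
    have hx' : clopenIndicator C x = 1 := indicator_of_mem (s := (C : Set K)) hx 1
    have hy' : clopenIndicator C y = 0 := indicator_of_notMem (s := (C : Set K)) hy 1
    simpa [hx', hy'] using (hpos (rank C)).ne'
  · refine Metric.totallyBounded_iff.2 fun ε hε => ?_
    obtain ⟨N, hN⟩ := exists_nat_gt (‖toL1 ν‖ / ε)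
    have hT : TotallyBounded (⋃ n ∈ Iio N, (fun v => ((n : ℝ) + 1)⁻¹ • v) ''
        ((fun C => toL1 ν (clopenIndicator C)) '' {C | rank C = n})) :=
      (totallyBounded_biUnion (finite_Iio N)).2 fun n _ =>
        (hrank n ν).image (uniformContinuous_const_smul _)
    obtain ⟨t, ht, hTt⟩ := Metric.totallyBounded_iff.1 hT ε hε
    refine ⟨insert 0 t, ht.insert 0, ?_⟩
    rintro _ ⟨C, rfl⟩
    simp only [map_smul]
    rcases lt_or_ge (rank C) N with hC | hC
    · obtain ⟨y, hy, hy'⟩ := mem_iUnion₂.1 (hTt (mem_iUnion₂.2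
        ⟨rank C, hC, mem_image_of_mem _ (mem_image_of_mem _ (show rank C = rank C from rfl))⟩))
      exact mem_iUnion₂.2 ⟨y, mem_insert_of_mem _ hy, hy'⟩
    · refine mem_iUnion₂.2 ⟨0, mem_insert _ _, mem_ball_zero_iff.2 ?_⟩
      rw [norm_smul, Real.norm_of_nonneg (hpos _).le, inv_mul_lt_iff₀ (by positivity)]
      have h1 := (toL1 ν).le_of_opNorm_le_of_le le_rfl (hnorm C)
      have h2 := (div_lt_iff₀ hε).1 hN
      have h3 : (N : ℝ) ≤ rank C := by exact_mod_cast hC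
      nlinarith

/-- Every finite weighted graph has a cut of nonnegative weight. -/
theorem exists_sign_sum_mul_nonpos {ι : Type*} (I : Finset ι) (w : ι → ℝ) (u v : ι → ℕ)
    (huv : ∀ i ∈ I, u i < v i) :
    ∃ θ : ℕ → ℝ, (∀ n, θ n = 1 ∨ θ n = -1) ∧ ∑ i ∈ I, w i * (θ (u i) * θ (v i)) ≤ 0 := by
  classical
  have key : ∀ N, ∃ θ : ℕ → ℝ, (∀ n, θ n = 1 ∨ θ n = -1) ∧
      ∑ i ∈ I with v i < N, w i * (θ (u i) * θ (v i)) ≤ 0 := by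
    intro N
    induction N with
    | zero => exact ⟨1, fun _ => Or.inl rfl, by simp⟩
    | succ N ih =>
      obtain ⟨θ, hθ, hsum⟩ := ih
      set S := ∑ i ∈ I with v i = N, w i * θ (u i) with hS
      obtain ⟨s, hs, hsS⟩ : ∃ s : ℝ, (s = 1 ∨ s = -1) ∧ s * S ≤ 0 := by
        rcases le_total S 0 with h | h
        · exact ⟨1, Or.inl rfl, by linarith⟩
        · exact ⟨-1, Or.inr rfl, by linarith⟩
      refine ⟨update θ N s, fun n => ?_, ?_⟩
      · by_cases hn : n = N
        · subst hn; simpa using hs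
        · simpa [hn] using hθ n
      · have hsplit : (I.filter fun i => v i < N + 1) =
            (I.filter fun i => v i < N) ∪ I.filter fun i => v i = N := by
          ext i
          simp only [Finset.mem_filter, Finset.mem_union]
          have : v i < N + 1 ↔ v i < N ∨ v i = N := by omega
          tauto
        rw [hsplit, Finset.sum_union (Finset.disjoint_filter.2 fun i _ h1 h2 => by omega)]
        have h1 : ∑ i ∈ I with v i < N, w i * (update θ N s (u i) * update θ N s (v i)) =
            ∑ i ∈ I with v i < N, w i * (θ (u i) * θ (v i)) := by
          refine Finset.sum_congr rfl fun i hi => ?_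
          obtain ⟨hi, hiN⟩ := Finset.mem_filter.1 hi
          have := huv i hi
          rw [update_of_ne (by omega), update_of_ne (by omega)]
        have h2 : ∑ i ∈ I with v i = N, w i * (update θ N s (u i) * update θ N s (v i)) =
            s * S := by
          rw [hS, Finset.mul_sum]
          refine Finset.sum_congr rfl fun i hi => ?_
          obtain ⟨hi, hiN⟩ := Finset.mem_filter.1 hi
          have := huv i hi
          rw [hiN, update_of_ne (by omega), update_self]
          ring
        rw [h1, h2]
        linarith
  obtain ⟨θ, hθ, h⟩ := key (∑ i ∈ I, v i + 1)
  refine ⟨θ, hθ, ?_⟩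
  rwa [Finset.filter_true_of_mem fun i hi =>
    Nat.lt_succ_of_le (Finset.single_le_sum (f := v) (fun _ _ => Nat.zero_le _) hi)] at h

theorem sum_sum_mul_smul {ι E : Type*} [AddCommGroup E] [Module ℝ E] (I : Finset ι) (c : ι → ℝ)
    (u v : ι → ℕ) (g : ℕ → E) :
    ∑ n ∈ I.image u ∪ I.image v,
        (∑ i ∈ I, c i * ((if n = u i then 1 else 0) - if n = v i then 1 else 0)) • g n =
      ∑ i ∈ I, c i • (g (u i) - g (v i)) := by
  simp only [Finset.sum_smul]
  rw [Finset.sum_comm]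
  refine Finset.sum_congr rfl fun i hi => ?_
  have hu : u i ∈ I.image u ∪ I.image v := Finset.mem_union_left _ (Finset.mem_image_of_mem _ hi)
  have hv : v i ∈ I.image u ∪ I.image v := Finset.mem_union_right _ (Finset.mem_image_of_mem _ hi)
  simp only [mul_smul, ← Finset.smul_sum, sub_smul, Finset.sum_sub_distrib, ite_smul, one_smul,
    zero_smul, Finset.sum_ite_eq', hu, hv, if_true]

/-- If `f` dominates the unit vectors of `ℓ¹` with constant `ε`, then no convex combination of the
functions `|f k - f l|`, `k < l`, is everywhere smaller than `ε`. -/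
theorem exists_le_of_mem_convexHull_abs_sub {K : Type*} [TopologicalSpace K] [CompactSpace K]
    (f : ℕ → C(K, ℝ)) {ε : ℝ} (hε : 0 < ε)
    (hf : ∀ (s : Finset ℕ) (c : ℕ → ℝ), ε * ∑ k ∈ s, |c k| ≤ ‖∑ k ∈ s, c k • f k‖) {h : C(K, ℝ)}
    (hh : h ∈ convexHull ℝ {g | ∃ k l, k < l ∧ g = |f k - f l|}) : ∃ x, ε ≤ h x := by
  by_contra! hlt
  rw [convexHull_eq] at hh
  obtain ⟨ι, I, w, z, hw, hw1, hz, rfl⟩ := hh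
  choose! u v huv hz using hz
  obtain ⟨θ, hθ, hcut⟩ := exists_sign_sum_mul_nonpos I w u v huv
  have hθabs : ∀ n, |θ n| = 1 := fun n => by rcases hθ n with h | h <;> simp [h]
  have hθsq : ∀ n, θ n * θ n = 1 := fun n => by rcases hθ n with h | h <;> simp [h]
  let s : Finset ℕ := I.image u ∪ I.image v
  let a : ℕ → ℝ := fun n => ∑ i ∈ I, w i * (θ (u i) - θ (v i)) *
    ((if n = u i then 1 else 0) - if n = v i then 1 else 0)
  have hlow : 2 ≤ ∑ n ∈ s, |a n| := by
    calc (2 : ℝ) ≤ ∑ i ∈ I, (w i * (θ (u i) - θ (v i))) * (θ (u i) - θ (v i)) := by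
          have : ∀ i ∈ I, (w i * (θ (u i) - θ (v i))) * (θ (u i) - θ (v i)) =
              2 * w i - 2 * (w i * (θ (u i) * θ (v i))) := fun i _ => by
            linear_combination w i * hθsq (u i) + w i * hθsq (v i)
          rw [Finset.sum_congr rfl this, Finset.sum_sub_distrib, ← Finset.mul_sum,
            ← Finset.mul_sum, hw1]
          linarith
      _ = ∑ n ∈ s, a n * θ n := by
          simpa only [smul_eq_mul] using (sum_sum_mul_smul I (fun i => w i * (θ (u i) - θ (v i))) u v θ).symm
      _ ≤ _ := Finset.sum_le_sum fun n _ => by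
          refine (le_abs_self _).trans ?_
          rw [abs_mul, hθabs, mul_one]
  have hup : ‖∑ n ∈ s, a n • f n‖ < 2 * ε := by
    rw [sum_sum_mul_smul, ContinuousMap.norm_lt_iff _ (by positivity)]
    intro x
    have hx := hlt x
    rw [Finset.centerMass_eq_of_sum_1 _ _ hw1] at hx
    simp only [ContinuousMap.coe_sum, Finset.sum_apply, ContinuousMap.coe_smul, Pi.smul_apply,
      ContinuousMap.coe_sub, Pi.sub_apply, smul_eq_mul] at hx ⊢
    calc |∑ i ∈ I, w i * (θ (u i) - θ (v i)) * (f (u i) x - f (v i) x)|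
        ≤ ∑ i ∈ I, 2 * (w i * z i x) := by
          refine (Finset.abs_sum_le_sum_abs _ _).trans (Finset.sum_le_sum fun i hi => ?_)
          rw [hz i hi, ContinuousMap.abs_apply, abs_mul, abs_mul, abs_of_nonneg (hw i hi)]
          have h2 : |θ (u i) - θ (v i)| ≤ 2 := (abs_sub _ _).trans (by rw [hθabs, hθabs]; norm_num)
          have := mul_le_mul_of_nonneg_left h2 (hw i hi)
          have := mul_le_mul_of_nonneg_right this (abs_nonneg ((f (u i) - f (v i)) x))
          calc _ ≤ _ := this
            _ = _ := by ring
      _ < 2 * ε := by rw [← Finset.mul_sum]; linarith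
  have := hf s a
  nlinarith

/-- A sequence in `C(K)` that dominates the unit vectors of `ℓ¹` is uniformly separated in `L¹(ν)`
for some finite measure `ν`. -/
theorem exists_measure_forall_le_integral_abs_sub {K : Type*} [TopologicalSpace K] [CompactSpace K]
    [T2Space K] [MeasurableSpace K] [BorelSpace K]
    (f : ℕ → C(K, ℝ)) {ε : ℝ} (hε : 0 < ε)
    (hf : ∀ (s : Finset ℕ) (c : ℕ → ℝ), ε * ∑ k ∈ s, |c k| ≤ ‖∑ k ∈ s, c k • f k‖) :
    ∃ (ν : Measure K) (_ : IsFiniteMeasure ν) (u : ℝ), 0 < u ∧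
      ∀ k l, k ≠ l → u ≤ ∫ x, |f k x - f l x| ∂ν := by
  let s : Set C(K, ℝ) := {g | MapsTo g univ (Iio ε)}
  have hs : IsOpen s := ContinuousMap.isOpen_setOfPred_mapsTo isCompact_univ isOpen_Iio
  have hsc : Convex ℝ s := by
    intro g hg g' hg' a b ha hb hab x hx
    exact convex_Iio ε (hg hx) (hg' hx) ha hb hab
  obtain ⟨φ, u, hφs, hφ⟩ := geometric_hahn_banach_open hsc hs
    (convex_convexHull ℝ {g | ∃ k l, k < l ∧ g = |f k - f l|}) (disjoint_left.2 fun g hg hg' => by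
      obtain ⟨x, hx⟩ := exists_le_of_mem_convexHull_abs_sub f hε hf hg'
      exact (not_lt.2 hx) (hg (mem_univ x)))
  have hu : 0 < u := by
    simpa using hφs 0 fun x _ => hε
  have hpos : ∀ g : C(K, ℝ), 0 ≤ g → 0 ≤ φ g := by
    intro g hg
    by_contra! hneg
    have hmem : (u / φ g) • g ∈ s := fun x _ => by
      have h1 : u / φ g ≤ 0 := (div_neg_of_pos_of_neg hu hneg).le
      have h2 : 0 ≤ g x := hg x
      exact lt_of_le_of_lt (mul_nonpos_of_nonpos_of_nonneg h1 h2) hε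
    have := hφs _ hmem
    rw [map_smul, smul_eq_mul, div_mul_cancel₀ _ hneg.ne] at this
    exact lt_irrefl _ this
  let Λ₀ : CompactlySupportedContinuousMap K ℝ →ₗ[ℝ] ℝ :=
    { toFun := fun g => φ g
      map_add' := fun g g' => map_add φ (g : C(K, ℝ)) g'
      map_smul' := fun c g => map_smul φ c (g : C(K, ℝ)) }
  let Λ := PositiveLinearMap.mk₀ Λ₀ fun g hg => hpos g hg
  have hlt : ∀ k l, k < l → u ≤ ∫ x, |f k x - f l x| ∂(RealRMK.rieszMeasure Λ) := fun k l hkl => by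
    refine (hφ _ (subset_convexHull ℝ _ ⟨k, l, hkl, rfl⟩)).trans_eq ?_
    exact (RealRMK.integral_rieszMeasure Λ
      (CompactlySupportedContinuousMap.continuousMapEquiv |f k - f l|)).symm
  refine ⟨RealRMK.rieszMeasure Λ, inferInstance, u, hu, fun k l hkl => ?_⟩
  rcases hkl.lt_or_gt with h | h
  · exact hlt k l h
  · simpa only [abs_sub_comm] using hlt l k h

theorem sum_abs_le_norm_lp_one {ι : Type*} (a : lp (fun _ : ι => ℝ) 1) (s : Finset ι) :
    ∑ i ∈ s, |a i| ≤ ‖a‖ := by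
  simpa using lp.sum_rpow_le_norm_rpow (by simp) a s

/-- Every bounded family is the image of the unit vectors of `ℓ¹` under a bounded operator. -/
theorem exists_lp_one_continuousLinearMap {ι E : Type*} [DecidableEq ι] [NormedAddCommGroup E]
    [NormedSpace ℝ E] [CompleteSpace E] (w : ι → E) (hw : ∀ i, ‖w i‖ ≤ 1) :
    ∃ T : lp (fun _ : ι => ℝ) 1 →L[ℝ] E, (∀ i, T (lp.single 1 i 1) = w i) ∧
      ∀ a, HasSum (fun i => a i • w i) (T a) := by
  have hsum : ∀ a : lp (fun _ : ι => ℝ) 1, Summable fun i => |a i| := fun a =>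
    summable_of_sum_le (fun i => abs_nonneg _) (sum_abs_le_norm_lp_one a)
  have hbd : ∀ (a : lp (fun _ : ι => ℝ) 1) i, ‖a i • w i‖ ≤ |a i| := fun a i => by
    rw [norm_smul, Real.norm_eq_abs]
    exact mul_le_of_le_one_right (abs_nonneg _) (hw i)
  have hs : ∀ a : lp (fun _ : ι => ℝ) 1, Summable fun i => a i • w i := fun a =>
    Summable.of_norm_bounded (hsum a) (hbd a)
  let T₀ : lp (fun _ : ι => ℝ) 1 →ₗ[ℝ] E :=
    { toFun := fun a => ∑' i, a i • w i
      map_add' := fun a b => by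
        rw [← (hs a).tsum_add (hs b)]
        simp [add_smul]
      map_smul' := fun c a => by
        rw [RingHom.id_apply, ← (hs a).tsum_const_smul]
        simp [mul_smul] }
  refine ⟨T₀.mkContinuous 1 fun a => ?_, fun i => ?_, fun a => (hs a).hasSum⟩
  · rw [one_mul]
    exact (tsum_of_norm_bounded (hsum a).hasSum (hbd a)).trans
      ((hsum a).tsum_le_of_sum_le (sum_abs_le_norm_lp_one a))
  · change ∑' j, (lp.single 1 i (1 : ℝ) : lp (fun _ : ι => ℝ) 1) j • w j = w i
    rw [tsum_eq_single i fun j hj => by rw [lp.single_apply_ne _ _ _ hj, zero_smul],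
      lp.single_apply_self, one_smul]

theorem sum_smul_mem_absConvexHull {ι E : Type*} [AddCommGroup E] [Module ℝ E] {S : Set E}
    [Nonempty S] {v : ι → E} (hv : ∀ i, v i ∈ S) (s : Finset ι) (a : ι → ℝ)
    (ha : ∑ i ∈ s, |a i| ≤ 1) : ∑ i ∈ s, a i • v i ∈ absConvexHull ℝ S := by
  set A := ∑ i ∈ s, |a i| with hA
  rcases (Finset.sum_nonneg fun i _ => abs_nonneg (a i) : 0 ≤ A).eq_or_lt with h0 | h0
  · have : ∀ i ∈ s, a i • v i = 0 := fun i hi => by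
      rw [abs_eq_zero.1 ((Finset.sum_eq_zero_iff_of_nonneg fun i _ => abs_nonneg (a i)).1
        h0.symm i hi), zero_smul]
    rw [Finset.sum_eq_zero this]
    exact zero_mem_absConvexHull
  · have h1 : ∑ i ∈ s, (|a i| / A) • ((SignType.sign (a i) : ℝ) • v i) ∈ absConvexHull ℝ S := by
      refine convex_absConvexHull.sum_mem (fun i _ => by positivity) ?_ fun i _ => ?_
      · rw [← Finset.sum_div, div_self h0.ne']
      · refine balanced_absConvexHull.smul_mem ?_ (subset_absConvexHull (hv i))
        rcases lt_trichotomy (a i) 0 with h | h | h <;> simp [h]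
    have h2 := balanced_absConvexHull.smul_mem (a := A)
      (by rwa [Real.norm_of_nonneg h0.le]) h1
    convert h2 using 1
    rw [Finset.smul_sum]
    refine Finset.sum_congr rfl fun i _ => ?_
    rw [smul_smul, smul_smul, mul_div_cancel₀ _ h0.ne', abs_mul_sign]

/-- The balls of `ℓ¹` are mapped onto totally bounded sets as soon as the unit vectors are. -/
theorem totallyBounded_image_closedBall {ι E F : Type*} [NormedAddCommGroup E] [NormedSpace ℝ E]
    [NormedAddCommGroup F] [NormedSpace ℝ F] (J : E →L[ℝ] F) (w : ι → E)
    (hw : TotallyBounded (range fun i => J (w i))) (T : lp (fun _ : ι => ℝ) 1 → E)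
    (hT : ∀ a, HasSum (fun i => a i • w i) (T a)) (M : ℝ) :
    TotallyBounded ((fun a => J (T a)) '' Metric.closedBall 0 M) := by
  set S : Set F := insert 0 (range fun i => J (w i)) with hS
  have hSn : Nonempty S := ⟨0, mem_insert _ _⟩
  have hB : TotallyBounded ((fun x => (|M| + 1) • x) '' closure (absConvexHull ℝ S)) :=
    ((hw.insert 0).absConvexHull.closure).image (uniformContinuous_const_smul _)
  have hM : 0 < |M| + 1 := by positivity
  refine hB.subset ?_
  rintro _ ⟨a, ha, rfl⟩
  refine ⟨(|M| + 1)⁻¹ • J (T a), ?_, smul_inv_smul₀ hM.ne' _⟩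
  have h1 : HasSum (fun i => ((|M| + 1)⁻¹ * a i) • J (w i)) ((|M| + 1)⁻¹ • J (T a)) := by
    simpa [mul_smul] using (J.hasSum (hT a)).const_smul (|M| + 1)⁻¹
  refine mem_closure_of_tendsto h1 (Eventually.of_forall fun s => ?_)
  refine sum_smul_mem_absConvexHull (fun i => mem_insert_of_mem _ (mem_range_self i)) s _ ?_
  have h2 := sum_abs_le_norm_lp_one a s
  have h3 := mem_closedBall_zero_iff.1 ha
  simp only [abs_mul, ← Finset.mul_sum, abs_inv, abs_of_pos hM]
  rw [inv_mul_le_iff₀ hM]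
  linarith [le_abs_self M]

theorem TotallyBounded.exists_ne_dist_lt {E : Type*} [PseudoMetricSpace E] {S : Set E}
    (hS : TotallyBounded S) (v : ℕ → E) (hv : ∀ k, v k ∈ S) {r : ℝ} (hr : 0 < r) :
    ∃ k l, k ≠ l ∧ dist (v k) (v l) < r := by
  obtain ⟨t, ht, hSt⟩ := Metric.totallyBounded_iff.1 hS (r / 2) (half_pos hr)
  have hex : ∀ k, ∃ y : t, dist (v k) y < r / 2 := fun k => by
    obtain ⟨y, hy, hky⟩ := mem_iUnion₂.1 (hSt (hv k))
    exact ⟨⟨y, hy⟩, hky⟩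
  choose y hy using hex
  have := ht.to_subtype
  obtain ⟨k, l, hkl, hykl⟩ := Finite.exists_ne_map_eq_of_infinite y
  refine ⟨k, l, hkl, (dist_triangle_right _ _ (y k : E)).trans_lt ?_⟩
  have := hy l
  rw [← hykl] at this
  linarith [hy k]

/-- A sequence in `C(K)` that for all `n` lies in a set of the form `2ⁿ T(A) + 2⁻ⁿ B` with `A`, `B`
bounded does not dominate the unit vectors of `ℓ¹`, provided that `T` maps bounded sets to totally
bounded sets in all `L¹(ν)`. -/
theorem exists_norm_sum_smul_lt {K V : Type*} [TopologicalSpace K] [CompactSpace K]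
    [T2Space K] [MeasurableSpace K] [BorelSpace K] [NormedAddCommGroup V] (T : V → C(K, ℝ))
    (hT : ∀ (ν : Measure K) [IsFiniteMeasure ν] (M : ℝ),
      TotallyBounded ((fun a => toL1 ν (T a)) '' Metric.closedBall 0 M))
    (f : ℕ → C(K, ℝ)) {M : ℝ} (a : ℕ → ℕ → V) (g : ℕ → ℕ → C(K, ℝ)) (ha : ∀ n k, ‖a n k‖ ≤ M)
    (hg : ∀ n k, ‖g n k‖ ≤ M) (hf : ∀ n k, f k = (2 : ℝ) ^ n • T (a n k) + ((2 : ℝ) ^ n)⁻¹ • g n k)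
    {ε : ℝ} (hε : 0 < ε) :
    ∃ (s : Finset ℕ) (c : ℕ → ℝ), ‖∑ k ∈ s, c k • f k‖ < ε * ∑ k ∈ s, |c k| := by
  by_contra! hcon
  obtain ⟨ν, hν, u, hu, huf⟩ := exists_measure_forall_le_integral_abs_sub f hε hcon
  have hM : 0 ≤ M := (norm_nonneg _).trans (ha 0 0)
  obtain ⟨n, hn⟩ := pow_unbounded_of_one_lt (4 * (‖toL1 ν‖ * M) / u) (one_lt_two : (1 : ℝ) < 2)
  have h2n : (0 : ℝ) < 2 ^ n := by positivity
  obtain ⟨k, l, hkl, hd⟩ := (hT ν M).exists_ne_dist_lt (fun k => toL1 ν (T (a n k)))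
    (fun k => ⟨a n k, mem_closedBall_zero_iff.2 (ha n k), rfl⟩)
    (r := u / 2 / 2 ^ n) (by positivity)
  have h1 := huf k l hkl
  rw [← dist_toL1, hf n k, hf n l, dist_eq_norm] at h1
  rw [dist_eq_norm, lt_div_iff₀ h2n] at hd
  have h2 : ‖toL1 ν ((2 : ℝ) ^ n • T (a n k) + ((2 : ℝ) ^ n)⁻¹ • g n k) -
      toL1 ν ((2 : ℝ) ^ n • T (a n l) + ((2 : ℝ) ^ n)⁻¹ • g n l)‖ ≤
      2 ^ n * ‖toL1 ν (T (a n k)) - toL1 ν (T (a n l))‖ +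
        (2 ^ n)⁻¹ * (‖toL1 ν‖ * (M + M)) := by
    have heq : toL1 ν ((2 : ℝ) ^ n • T (a n k) + ((2 : ℝ) ^ n)⁻¹ • g n k) -
      toL1 ν ((2 : ℝ) ^ n • T (a n l) + ((2 : ℝ) ^ n)⁻¹ • g n l) =
        (2 : ℝ) ^ n • (toL1 ν (T (a n k)) - toL1 ν (T (a n l))) +
          ((2 : ℝ) ^ n)⁻¹ • toL1 ν (g n k - g n l) := by
      simp only [map_add, map_smul, map_sub]
      module
    rw [heq]
    refine (norm_add_le _ _).trans (add_le_add ?_ ?_)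
    · rw [norm_smul, Real.norm_of_nonneg h2n.le]
    · rw [norm_smul, Real.norm_of_nonneg (inv_nonneg.2 h2n.le)]
      gcongr
      exact (toL1 ν).le_of_opNorm_le_of_le le_rfl
        ((norm_sub_le _ _).trans (add_le_add (hg n k) (hg n l)))
  have h3 : (2 ^ n)⁻¹ * (‖toL1 ν‖ * (M + M)) < u / 2 := by
    rw [inv_mul_lt_iff₀ h2n]
    rw [div_lt_iff₀ hu] at hn
    linarith
  linarith

/-- The Banach space of common values of a sequence of bounded operators `L n : Z → E`, with the
quotient norm. -/
theorem exists_common_value_space {Z E : Type} [NormedAddCommGroup Z] [NormedSpace ℝ Z]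
    [CompleteSpace Z] [NormedAddCommGroup E] [NormedSpace ℝ E] (L : ℕ → Z →L[ℝ] E) :
    ∃ (X : Type) (_ : NormedAddCommGroup X) (_ : NormedSpace ℝ X) (_ : CompleteSpace X)
      (J : X →L[ℝ] E), (∀ x R, ‖x‖ < R → ∃ z, ‖z‖ < R ∧ ∀ n, L n z = J x) ∧
        (∀ x z, (∀ n, L n z = J x) → ‖x‖ ≤ ‖z‖) ∧
        ∀ z, (∀ n, L n z = L 0 z) → ∃ x, J x = L 0 z := by
  let W : Submodule ℝ Z := ⨅ n, (L n - L 0).ker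
  have hmem : ∀ z, z ∈ W ↔ ∀ n, L n z = L 0 z := fun z => by
    simp [W, Submodule.mem_iInf, sub_eq_zero]
  have hWc : IsClosed (W : Set Z) := by
    simp only [W, Submodule.coe_iInf]
    exact isClosed_iInter fun n => (L n - L 0).isClosed_ker
  have hWcomp : CompleteSpace W := hWc.completeSpace_coe
  let L₀ : W →L[ℝ] E := (L 0).comp W.subtypeL
  let N : Submodule ℝ W := L₀.ker
  have hN : IsClosed (N : Set W) := L₀.isClosed_ker
  refine ⟨W ⧸ N, inferInstance, inferInstance, inferInstance, N.liftQL L₀ le_rfl, ?_, ?_, ?_⟩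
  · intro x R hx
    obtain ⟨z, rfl, hz⟩ := Submodule.Quotient.norm_mk_lt x (sub_pos.2 hx)
    exact ⟨z, by simpa using hz, (hmem z).1 z.2⟩
  · intro x z hz
    obtain ⟨y, rfl⟩ := Submodule.Quotient.mk_surjective N x
    let z' : W := ⟨z, (hmem z).2 fun n => (hz n).trans (hz 0).symm⟩
    have : Submodule.Quotient.mk y = (Submodule.Quotient.mk z' : W ⧸ N) := by
      refine (Submodule.Quotient.eq N).2 ?_
      change L₀ (y - z') = 0
      rw [map_sub, sub_eq_zero]
      exact (hz 0).symm
    rw [this]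
    exact Submodule.Quotient.norm_mk_le N z'
  · intro z hz
    exact ⟨Submodule.Quotient.mk ⟨z, (hmem z).2 hz⟩, rfl⟩

/-- Restriction of an `ℓ²` sequence to its first `N` coordinates. -/
noncomputable def lpTruncate {E : Type*} [NormedAddCommGroup E] (N : ℕ)
    (z : lp (fun _ : ℕ => E) 2) : lp (fun _ : ℕ => E) 2 :=
  ∑ n ∈ Finset.range N, lp.single 2 n (z n)

theorem lpTruncate_apply {E : Type*} [NormedAddCommGroup E] (N : ℕ)
    (z : lp (fun _ : ℕ => E) 2) (n : ℕ) : lpTruncate N z n = if n < N then z n else 0 := by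
  simp only [lpTruncate, lp.coeFn_sum, Finset.sum_apply, lp.coeFn_single, Finset.sum_pi_single,
    Finset.mem_range]

theorem norm_sq_eq_lpTruncate {E : Type*} [NormedAddCommGroup E] (N : ℕ)
    (z : lp (fun _ : ℕ => E) 2) :
    ‖z‖ ^ 2 = ‖lpTruncate N z‖ ^ 2 + ‖z - lpTruncate N z‖ ^ 2 := by
  have h1 := lp.norm_sub_norm_compl_sub_single (by simp) z (Finset.range N)
  have h2 := lp.norm_sum_single (p := 2) (by simp) (fun n => z n) (Finset.range N)
  simp only [ENNReal.toReal_ofNat, Real.rpow_ofNat] at h1 h2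
  rw [← h2, sub_eq_iff_eq_add] at h1
  exact h1

theorem norm_lpTruncate_add_sq {E : Type*} [NormedAddCommGroup E] (N : ℕ)
    (z z' : lp (fun _ : ℕ => E) 2) :
    ‖lpTruncate N z + (z' - lpTruncate N z')‖ ^ 2 =
      ‖lpTruncate N z‖ ^ 2 + ‖z' - lpTruncate N z'‖ ^ 2 := by
  rw [norm_sq_eq_lpTruncate N]
  have h : lpTruncate N (lpTruncate N z + (z' - lpTruncate N z')) = lpTruncate N z := by
    refine lp.ext (funext fun n => ?_)
    simp only [lpTruncate_apply, lp.coeFn_add, lp.coeFn_sub, Pi.add_apply, Pi.sub_apply]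
    split_ifs <;> simp
  rw [h, add_sub_cancel_left]

theorem tendsto_lpTruncate {E : Type*} [NormedAddCommGroup E] (z : lp (fun _ : ℕ => E) 2) :
    Tendsto (fun N => lpTruncate N z) atTop (𝓝 z) :=
  (lp.hasSum_single (by simp) z).tendsto_sum_nat

/-- The operators `(aₙ, gₙ)ₙ ↦ 2ⁿ T aₙ + 2⁻ⁿ gₙ`. -/
noncomputable def dyadicMap {V E : Type*} [NormedAddCommGroup V] [NormedSpace ℝ V]
    [NormedAddCommGroup E] [NormedSpace ℝ E] (T : V →L[ℝ] E) (n : ℕ) :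
    lp (fun _ : ℕ => V × E) 2 →L[ℝ] E :=
  ((2 : ℝ) ^ n • T.comp (ContinuousLinearMap.fst ℝ V E) +
    ((2 : ℝ) ^ n)⁻¹ • ContinuousLinearMap.snd ℝ V E).comp
      (lp.evalCLM ℝ (fun _ : ℕ => V × E) 2 n)

theorem dyadicMap_apply {V E : Type*} [NormedAddCommGroup V] [NormedSpace ℝ V]
    [NormedAddCommGroup E] [NormedSpace ℝ E] (T : V →L[ℝ] E) (n : ℕ)
    (z : lp (fun _ : ℕ => V × E) 2) :
    dyadicMap T n z = (2 : ℝ) ^ n • T (z n).1 + ((2 : ℝ) ^ n)⁻¹ • (z n).2 := rfl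

theorem exists_dyadicMap_eq {V E : Type*} [NormedAddCommGroup V] [NormedSpace ℝ V]
    [NormedAddCommGroup E] [NormedSpace ℝ E] (T : V →L[ℝ] E) (a : V) :
    ∃ z, ∀ n, dyadicMap T n z = T a := by
  have hmem : Memℓp (fun n : ℕ => ((((2 : ℝ) ^ n)⁻¹ • a, 0) : V × E)) 2 := by
    refine memℓp_gen ?_
    have h : Summable fun n : ℕ => (1 / 4 : ℝ) ^ n * ‖a‖ ^ 2 :=
      (summable_geometric_of_lt_one (by norm_num) (by norm_num)).mul_right _
    convert h using 2 with n
    rw [Prod.norm_mk, norm_zero, max_eq_left (norm_nonneg _), norm_smul,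
      ENNReal.toReal_ofNat, Real.rpow_ofNat, mul_pow, norm_inv, norm_pow, Real.norm_two, inv_pow,
      ← pow_mul, mul_comm n 2, pow_mul, one_div, inv_pow]
    norm_num
  refine ⟨⟨_, hmem⟩, fun n => ?_⟩
  rw [dyadicMap_apply]
  simp [smul_smul]

theorem norm_sum_smul_le {ι E : Type*} [NormedAddCommGroup E] [NormedSpace ℝ E] (s : Finset ι)
    (c : ι → ℝ) (v : ι → E) {R : ℝ} (hv : ∀ i, ‖v i‖ ≤ R) :
    ‖∑ i ∈ s, c i • v i‖ ≤ R * ∑ i ∈ s, |c i| := by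
  rw [Finset.mul_sum]
  refine norm_sum_le_of_le s fun i _ => ?_
  rw [norm_smul, Real.norm_eq_abs, mul_comm]
  exact mul_le_mul_of_nonneg_right (hv i) (abs_nonneg _)

/-- Modifying the first `N` coordinates, a small element of `E` has a lift whose first coordinates are
small. -/
theorem exists_dyadicMap_eq_add {V E : Type*} [NormedAddCommGroup V] [NormedSpace ℝ V]
    [NormedAddCommGroup E] [NormedSpace ℝ E] (T : V →L[ℝ] E) (N : ℕ) (e : E)
    (z : lp (fun _ : ℕ => V × E) 2) (hz : ∀ n, dyadicMap T n z = e) :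
    ∃ b : lp (fun _ : ℕ => V × E) 2, ‖b‖ ≤ 2 ^ N * ‖e‖ ∧
      ∀ n, dyadicMap T n (z - lpTruncate N z + b) = e := by
  refine ⟨∑ n ∈ Finset.range N, lp.single 2 n ((0, (2 : ℝ) ^ n • e) : V × E), ?_, fun n => ?_⟩
  · have h : ∀ M : ℕ, ∑ n ∈ Finset.range M, (2 : ℝ) ^ n ≤ 2 ^ M := fun M => by
      rw [geom_sum_eq (by norm_num)]
      norm_num
    calc _ ≤ ∑ n ∈ Finset.range N, (2 : ℝ) ^ n * ‖e‖ := by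
          refine norm_sum_le_of_le _ fun n _ => ?_
          rw [lp.norm_single (by norm_num), Prod.norm_mk, norm_zero, norm_smul,
            max_eq_right (by positivity), norm_pow, Real.norm_two]
      _ ≤ _ := by
          rw [← Finset.sum_mul]
          exact mul_le_mul_of_nonneg_right (h N) (norm_nonneg e)
  · rw [← hz n, dyadicMap_apply, dyadicMap_apply]
    simp only [lp.coeFn_add, lp.coeFn_sub, Pi.add_apply, Pi.sub_apply, lpTruncate_apply,
      lp.coeFn_sum, Finset.sum_apply, lp.coeFn_single, Finset.sum_pi_single, Finset.mem_range]
    split_ifs with h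
    · rw [← dyadicMap_apply, hz n]
      simp [smul_smul]
    · simp

/-- Let `J : X → E` describe the space of common values of the operators `(aₙ, gₙ)ₙ ↦ 2ⁿ T aₙ + 2⁻ⁿ gₙ`.
If sequences in `E` which are bounded in all the interpolation norms do not dominate the unit vectors
of `ℓ¹`, then every bounded sequence in `X` has a linear combination of strictly smaller norm
than the triangle inequality gives. -/
theorem exists_norm_sum_smul_le {V E X : Type*} [NormedAddCommGroup V] [NormedSpace ℝ V]
    [NormedAddCommGroup E] [NormedSpace ℝ E] [NormedAddCommGroup X] [NormedSpace ℝ X]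
    (T : V →L[ℝ] E) (J : X →L[ℝ] E)
    (hlift : ∀ x R, ‖x‖ < R → ∃ z, ‖z‖ < R ∧ ∀ n, dyadicMap T n z = J x)
    (hle : ∀ x z, (∀ n, dyadicMap T n z = J x) → ‖x‖ ≤ ‖z‖)
    (hT : ∀ (f : ℕ → E) (M : ℝ) (a : ℕ → ℕ → V) (g : ℕ → ℕ → E), (∀ n k, ‖a n k‖ ≤ M) →
      (∀ n k, ‖g n k‖ ≤ M) →
      (∀ n k, f k = (2 : ℝ) ^ n • T (a n k) + ((2 : ℝ) ^ n)⁻¹ • g n k) → ∀ ε : ℝ, 0 < ε →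
      ∃ (s : Finset ℕ) (c : ℕ → ℝ), ‖∑ k ∈ s, c k • f k‖ < ε * ∑ k ∈ s, |c k|)
    {R : ℝ} (hR : 0 < R) (ξ : ℕ → X) (hξ : ∀ k, ‖ξ k‖ ≤ R) :
    ∃ (m : ℕ) (c : ℕ → ℝ), ∑ k ∈ Finset.range m, |c k| = 1 ∧
      ‖∑ k ∈ Finset.range m, c k • ξ k‖ ≤ 9 / 10 * R := by
  set ρ := 101 / 100 * R with hρ
  choose z hzρ hz using fun k => hlift (ξ k) ρ (by have := hξ k; linarith)
  obtain ⟨N, hN⟩ := ((tendsto_lpTruncate (z 0)).eventually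
    (Metric.ball_mem_nhds _ (show 0 < R / 10 by positivity))).exists
  rw [dist_comm, dist_eq_norm] at hN
  obtain ⟨s, c, hsc⟩ := hT (fun k => J (ξ (k + 1))) ρ (fun n k => (z (k + 1) n).1)
    (fun n k => (z (k + 1) n).2)
    (fun n k => (norm_fst_le _).trans ((lp.norm_apply_le_norm (by norm_num) _ _).trans (hzρ _).le))
    (fun n k => (norm_snd_le _).trans ((lp.norm_apply_le_norm (by norm_num) _ _).trans (hzρ _).le))
    (fun n k => (hz (k + 1) n).symm) (R / 10 / 2 ^ N) (by positivity)
  set A := ∑ k ∈ s, |c k| with hA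
  have hA0 : 0 < A := by
    by_contra! h
    have h1 : R / 10 / 2 ^ N * A ≤ 0 := mul_nonpos_of_nonneg_of_nonpos (by positivity) h
    linarith [norm_nonneg (∑ k ∈ s, c k • J (ξ (k + 1)))]
  set y := ∑ k ∈ s, (c k / A) • ξ (k + 1) with hy
  set zy := ∑ k ∈ s, (c k / A) • z (k + 1) with hzy
  have hsum1 : ∑ k ∈ s, |c k / A| = 1 := by
    simp only [abs_div, abs_of_pos hA0, ← Finset.sum_div, ← hA, div_self hA0.ne']
  have hJy : 2 ^ N * ‖J y‖ ≤ R / 10 := by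
    have h1 : J y = A⁻¹ • ∑ k ∈ s, c k • J (ξ (k + 1)) := by
      simp only [hy, map_sum, map_smul, Finset.smul_sum, smul_smul, div_eq_inv_mul]
    rw [h1, norm_smul, norm_inv, Real.norm_of_nonneg hA0.le, mul_comm, ← le_div_iff₀ (by positivity),
      inv_mul_le_iff₀ hA0, mul_comm A]
    exact hsc.le
  have hzyJ : ∀ n, dyadicMap T n zy = J y := fun n => by
    simp only [hy, hzy, map_sum, map_smul, hz]
  have hzyρ : ‖zy‖ ≤ ρ := by
    simpa [hsum1] using norm_sum_smul_le s (fun k => c k / A) (fun k => z (k + 1))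
      fun k => (hzρ (k + 1)).le
  obtain ⟨b, hb, hbJ⟩ := exists_dyadicMap_eq_add T N (J y) zy hzyJ
  have hR0 : 0 ≤ ρ := by positivity
  have hsq : ‖lpTruncate N (z 0) + (zy - lpTruncate N zy)‖ ≤ 3 / 2 * R := by
    have h1 := norm_lpTruncate_add_sq N (z 0) zy
    have h2 := norm_sq_eq_lpTruncate N (z 0)
    have h3 := norm_sq_eq_lpTruncate N zy
    have h4 : ‖z 0‖ ^ 2 ≤ ρ ^ 2 := pow_le_pow_left₀ (norm_nonneg _) (hzρ 0).le 2
    have h5 : ‖zy‖ ^ 2 ≤ ρ ^ 2 := pow_le_pow_left₀ (norm_nonneg _) hzyρ 2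
    refine le_of_sq_le_sq ?_ (by positivity)
    nlinarith [sq_nonneg ‖z 0 - lpTruncate N (z 0)‖, sq_nonneg ‖lpTruncate N zy‖]
  have hfin : ‖ξ 0 + y‖ ≤ 9 / 5 * R := by
    have h1 := hle (ξ 0 + y) (z 0 + (zy - lpTruncate N zy + b)) fun n => by
      rw [map_add (dyadicMap T n) (z 0), hz, hbJ, map_add]
    have h2 : z 0 + (zy - lpTruncate N zy + b) = (lpTruncate N (z 0) + (zy - lpTruncate N zy)) +
        (z 0 - lpTruncate N (z 0)) + b := by abel
    rw [h2] at h1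
    have h3 := norm_add₃_le (a := lpTruncate N (z 0) + (zy - lpTruncate N zy))
      (b := z 0 - lpTruncate N (z 0)) (c := b)
    linarith
  obtain ⟨m, hm⟩ := s.exists_nat_subset_range
  let d : ℕ → ℝ := fun k => if k ∈ s then c k / A else 0
  refine ⟨m + 1, fun k => (1 / 2) * Nat.casesOn k 1 d, ?_, ?_⟩
  · rw [Finset.sum_range_succ']
    have : ∑ k ∈ Finset.range m, |d k| = 1 := by
      rw [← hsum1, ← Finset.sum_subset hm fun k _ hk => by simp [d, hk]]
      exact Finset.sum_congr rfl fun k hk => by simp [d, hk]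
    simp only [abs_mul, ← Finset.mul_sum, this]
    norm_num
  · rw [Finset.sum_range_succ']
    have : ∑ k ∈ Finset.range m, d k • ξ (k + 1) = y := by
      rw [hy, ← Finset.sum_subset hm fun k _ hk => by simp [d, hk]]
      exact Finset.sum_congr rfl fun k hk => by simp [d, hk]
    simp only [mul_smul, ← Finset.smul_sum, this]
    rw [← smul_add, norm_smul, add_comm y]
    norm_num
    linarith

/-- If every bounded sequence has a linear combination whose norm is smaller, by a constant factor,
than the triangle inequality gives, then there is no copy of `ℓ¹`. -/
theorem not_containsL1_of_contraction {X : Type*} [NormedAddCommGroup X] [NormedSpace ℝ X] {θ : ℝ}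
    (hθ : 0 < θ) (hθ1 : θ < 1)
    (h : ∀ R : ℝ, 0 < R → ∀ ξ : ℕ → X, (∀ k, ‖ξ k‖ ≤ R) → ∃ (m : ℕ) (c : ℕ → ℝ),
      ∑ k ∈ Finset.range m, |c k| = 1 ∧ ‖∑ k ∈ Finset.range m, c k • ξ k‖ ≤ θ * R) :
    ¬ ContainsL1 X := by
  rintro ⟨U, κ, hκ, hU⟩
  set R := ‖U‖ + 1 with hR
  have hR0 : 0 < R := by positivity
  have key : ∀ n : ℕ, ∃ ξ : ℕ → X, (∀ k, ‖ξ k‖ ≤ θ ^ n * R) ∧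
      ∀ (s : Finset ℕ) (c : ℕ → ℝ), κ * ∑ k ∈ s, |c k| ≤ ‖∑ k ∈ s, c k • ξ k‖ := by
    intro n
    induction n with
    | zero =>
      refine ⟨fun k => U (lp.single 1 k 1), fun k => ?_, fun s c => ?_⟩
      · refine (U.le_opNorm _).trans ?_
        rw [lp.norm_single (by norm_num)]
        simp [hR]
      · have h1 : ∑ k ∈ s, c k • U (lp.single 1 k 1) =
            U (∑ k ∈ s, lp.single 1 k (c k)) := by
          rw [map_sum]
          refine Finset.sum_congr rfl fun k _ => ?_
          rw [← map_smul, ← lp.single_smul]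
          simp
        have h2 := lp.norm_sum_single (E := fun _ : ℕ => ℝ) (p := 1) (by norm_num) c s
        simp only [ENNReal.toReal_one, Real.rpow_one, Real.norm_eq_abs] at h2
        rw [h1, ← h2]
        exact hU _
    | succ n ih =>
      obtain ⟨ξ, hξ, hlow⟩ := ih
      choose m c hc hm using fun a : ℕ => h (θ ^ n * R) (by positivity) (fun k => ξ (k + a))
        fun k => hξ _
      let a : ℕ → ℕ := fun j => Nat.rec 0 (fun _ b => b + m b) j
      have ha : ∀ j, a (j + 1) = a j + m (a j) := fun j => rfl
      have hmono : Monotone a := monotone_nat_of_le_succ fun j => by rw [ha]; omega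
      refine ⟨fun j => ∑ k ∈ Finset.range (m (a j)), c (a j) k • ξ (k + a j), fun j => ?_,
        fun s d => ?_⟩
      · rw [pow_succ', mul_assoc]
        exact hm _
      · let B : ℕ → Finset ℕ := fun j => Finset.Ico (a j) (a (j + 1))
        have hB : (s : Set ℕ).PairwiseDisjoint B := by
          have h3 := hmono.pairwise_disjoint_on_Ico_succ
          intro i _ j _ hij
          exact Finset.disjoint_left.2 fun x hx hx' => Set.disjoint_left.1 (h3 hij)
            (Finset.mem_Ico.1 hx) (Finset.mem_Ico.1 hx')
        have hex : ∀ i, ∃ x : ℝ, ∀ j ∈ s, i ∈ B j → x = d j * c (a j) (i - a j) := by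
          intro i
          by_cases hi : ∃ j ∈ s, i ∈ B j
          · obtain ⟨j, hj, hij⟩ := hi
            refine ⟨d j * c (a j) (i - a j), fun j' hj' hij' => ?_⟩
            have : j = j' := hB.elim hj hj' (Finset.not_disjoint_iff.2 ⟨i, hij, hij'⟩)
            rw [this]
          · exact ⟨0, fun j hj hij => absurd ⟨j, hj, hij⟩ hi⟩
        choose e he using hex
        have h4 := hlow (s.biUnion B) e
        rw [Finset.sum_biUnion hB, Finset.sum_biUnion hB] at h4
        have h5 : ∀ j ∈ s, ∑ i ∈ B j, |e i| = |d j| := fun j hj => by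
          rw [Finset.sum_congr rfl fun i hi => by rw [he i j hj hi], Finset.sum_Ico_eq_sum_range,
            ha, Nat.add_sub_cancel_left]
          simp only [Nat.add_sub_cancel_left, abs_mul]
          rw [← Finset.mul_sum, hc, mul_one]
        have h6 : ∀ j ∈ s, ∑ i ∈ B j, e i • ξ i =
            d j • ∑ k ∈ Finset.range (m (a j)), c (a j) k • ξ (k + a j) := fun j hj => by
          rw [Finset.sum_congr rfl fun i hi => by rw [he i j hj hi], Finset.sum_Ico_eq_sum_range,
            ha, Nat.add_sub_cancel_left]
          simp only [Nat.add_sub_cancel_left, Finset.smul_sum, smul_smul]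
          exact Finset.sum_congr rfl fun k _ => by rw [add_comm]
        rw [Finset.sum_congr rfl h5, Finset.sum_congr rfl h6] at h4
        exact h4
  have hlim : Filter.Tendsto (fun n : ℕ => θ ^ n * R) Filter.atTop (nhds 0) := by
    simpa using (tendsto_pow_atTop_nhds_zero_of_lt_one hθ.le hθ1).mul_const R
  obtain ⟨n, hn⟩ := (hlim.eventually (gt_mem_nhds hκ)).exists
  obtain ⟨ξ, hξ, hlow⟩ := key n
  have := hlow {0} 1
  simp only [Finset.sum_singleton, Pi.one_apply, abs_one, mul_one, one_smul] at this
  linarith [hξ 0]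

theorem isWRN_of_homeomorph {K L : Type*} [TopologicalSpace K] [TopologicalSpace L] (e : K ≃ₜ L)
    (h : IsWRN L) : IsWRN K := by
  obtain ⟨X, i₁, i₂, i₃, S, h₁, h₂, ⟨f⟩⟩ := h
  exact ⟨X, i₁, i₂, i₃, S, h₁, h₂, ⟨e.trans f⟩⟩

/-- A compact space whose points are separated by a Banach space `X` of continuous functions not
containing `ℓ¹` is weakly Radon–Nikodým. -/
theorem isWRN_of_separating {K : Type*} [TopologicalSpace K] [CompactSpace K] {X : Type}
    [NormedAddCommGroup X] [NormedSpace ℝ X] [CompleteSpace X] (hX : ¬ ContainsL1 X)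
    (J : X →L[ℝ] C(K, ℝ)) (hJ : ∀ x y, x ≠ y → ∃ v, J v x ≠ J v y) : IsWRN K := by
  let Φ : K → WeakDual ℝ X := fun x =>
    StrongDual.toWeakDual ((ContinuousMap.evalCLM ℝ x).comp J)
  have hΦ : ∀ x v, Φ x v = J v x := fun _ _ => rfl
  have hc : Continuous Φ := WeakDual.continuous_of_continuous_eval fun v => (J v).continuous
  have hi : Injective Φ := fun x y hxy => by
    by_contra hne
    obtain ⟨v, hv⟩ := hJ x y hne
    exact hv (by rw [← hΦ, hxy, hΦ])
  exact ⟨X, inferInstance, inferInstance, inferInstance, range Φ, hX, isCompact_range hc,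
    ⟨(hc.isClosedEmbedding hi).isEmbedding.toHomeomorph⟩⟩

theorem isWRN_of_separating_totallyBounded {K : Type} [TopologicalSpace K] [CompactSpace K]
    [T2Space K] [MeasurableSpace K] [BorelSpace K] {ι : Type} (w : ι → C(K, ℝ))
    (hw : ∀ i, ‖w i‖ ≤ 1) (hsep : ∀ x y, x ≠ y → ∃ i, w i x ≠ w i y)
    (htb : ∀ (ν : Measure K) [IsFiniteMeasure ν], TotallyBounded (range fun i => toL1 ν (w i))) :
    IsWRN K := by
  classical
  obtain ⟨T, hTw, hT⟩ := exists_lp_one_continuousLinearMap w hw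
  obtain ⟨X, _, _, _, J, hlift, hle, hrange⟩ := exists_common_value_space (dyadicMap T)
  have hX : ¬ ContainsL1 X :=
    not_containsL1_of_contraction (by norm_num : (0 : ℝ) < 9 / 10) (by norm_num) fun R hR ξ hξ =>
      exists_norm_sum_smul_le T J hlift hle (fun f M a g ha hg hf ε hε =>
        exists_norm_sum_smul_lt T
          (fun ν _ M => totallyBounded_image_closedBall (toL1 ν) w (htb ν) T hT M)
          f a g ha hg hf hε) hR ξ hξ
  refine isWRN_of_separating hX J fun x y hxy => ?_
  obtain ⟨i, hi⟩ := hsep x y hxy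
  obtain ⟨z, hz⟩ := exists_dyadicMap_eq T (lp.single 1 i 1)
  obtain ⟨v, hv⟩ := hrange z fun n => by rw [hz, hz]
  exact ⟨v, by rwa [hv, hz, hTw]⟩

/-- Every zero-dimensional QWRN compact Hausdorff space is WRN. -/
theorem isWRN_of_zeroDimensional_isQWRN
    (K : Type*) [TopologicalSpace K] [CompactSpace K] [T2Space K]
    (hzd : ∃ B : Set (Set K), (∀ s ∈ B, IsClopen s) ∧ TopologicalSpace.IsTopologicalBasis B)
    (hq : IsQWRN K) : IsWRN K := by
  obtain ⟨Γ, i, hi, hΓ⟩ := hq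
  let e : K ≃ₜ range i := hi.toHomeomorph
  have he : ∀ x, ((e x : range i) : Γ → unitInterval) = i x := fun _ => rfl
  have : CompactSpace (range i) := e.compactSpace
  let _ : MeasurableSpace (range i) := borel _
  have : BorelSpace (range i) := ⟨rfl⟩
  refine isWRN_of_homeomorph e ?_
  have hclopen : ∀ x y : range i, x ≠ y →
      ∃ C : TopologicalSpace.Clopens (range i), x ∈ C ∧ y ∉ C := fun x y hxy => by
    obtain ⟨B, hB, hbasis⟩ := hzd
    obtain ⟨s, hs, hxs, hys⟩ := hbasis.exists_subset_of_mem_open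
      (show e.symm x ∈ ({e.symm y}ᶜ : Set K) from fun h => hxy (e.symm.injective h))
      isOpen_compl_singleton
    exact ⟨⟨e.symm ⁻¹' s, (hB s hs).preimage e.symm.continuous⟩, hxs, fun h => hys h rfl⟩
  obtain ⟨w, hw, hsep, htb⟩ := exists_separating_totallyBounded hclopen
    (fun α : Γ => (⟨fun x => x.1 α, (continuous_apply α).comp continuous_subtype_val⟩ :
      C(range i, unitInterval)))
    (fun x y hxy => by
      by_contra! h
      exact hxy (Subtype.ext (funext h)))
    (fun ε hε => by
      obtain ⟨Γs, hΓs, h⟩ := hΓ ε hε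
      refine ⟨Γs, hΓs, fun n p q hpq => ?_⟩
      rintro ⟨φ, hφ, hind⟩
      refine h n p q hpq ⟨φ, hφ, fun N σ => ?_⟩
      obtain ⟨x, hx⟩ := hind N σ
      obtain ⟨x, rfl⟩ := e.surjective x
      refine ⟨x, mem_iInter.2 fun k => ?_⟩
      have := mem_iInter.1 hx k
      split_ifs at this ⊢ <;> exact this)
  exact isWRN_of_separating_totallyBounded w hw hsep htb
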